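/- arXiv:2403.17480 — 2 statements merged into one kernel-verified Lean document; each statement's English description precedes it below -/
import Mathlib

section
/- For α = 1, the competitive-ratio guarantee of 2 for the algorithm A_f that sets s(t) = n(t) is tight: for every ε > 0 there exist an arrival sequence a and a feasible schedule s' such that C(A_f) ≥ (2 − ε)·C(s'). In particular, for the arrival sequence in which x jobs (x even) arrive at each of the times 2, 4, …, 2k and no other jobs arrive, A_f has cost 3kx, while the feasible schedule that serves x/2 jobs per slot starting from slot 2 has cost at most 1.5kx + x. -/
open scoped BigOperators ENNReal

/-- Cumulative arrivals up to and including slot `t`. -/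
def cumA (a : ℕ → ℕ) (t : ℕ) : ℕ := ∑ τ ∈ Finset.range (t + 1), a τ

/-- Cumulative service strictly before slot `t`. -/
def cumS (s : ℕ → ℕ) (t : ℕ) : ℕ := ∑ τ ∈ Finset.range t, s τ

/-- Backlog (number of outstanding unit-size jobs) of schedule `s` at slot `t`. -/
def backlog (a s : ℕ → ℕ) (t : ℕ) : ℕ := cumA a t - cumS s t

/-- A schedule is feasible if it never serves more jobs than are outstanding. -/
def Feasible (a s : ℕ → ℕ) : Prop := ∀ t, s t ≤ backlog a s t

/-- Finite support of the arrival sequence. -/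
def FinSupp (a : ℕ → ℕ) : Prop := ∃ T, ∀ t, T < t → a t = 0

/-- `s (t-1)` with the convention `s (-1) = 0`. -/
def sPrev (s : ℕ → ℕ) : ℕ → ℕ
  | 0 => 0
  | t + 1 => s t

/-- Flow time plus linear switching cost, with weight `α`. -/
noncomputable def costLin (α : ℝ) (a s : ℕ → ℕ) : ℝ≥0∞ :=
  (∑' t, (backlog a s t : ℝ≥0∞)) +
    ENNReal.ofReal α * ∑' t, (((s t : ℤ) - (sPrev s t : ℤ)).natAbs : ℝ≥0∞)

/-- Flow time plus quadratic switching cost, with weight `α`. -/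
noncomputable def costQuad (α : ℝ) (a s : ℕ → ℕ) : ℝ≥0∞ :=
  (∑' t, (backlog a s t : ℝ≥0∞)) +
    ENNReal.ofReal α * ∑' t, ((((s t : ℤ) - (sPrev s t : ℤ)).natAbs ^ 2 : ℕ) : ℝ≥0∞)

/-- State machine of an online algorithm: the state at slot `t` is the pair
`(backlog at t, number of active servers at t)`, where the number of active
servers is `g` applied to the current backlog and the previous action
(with the convention that the action at slot `-1` is `0`). -/
def algState (a : ℕ → ℕ) (g : ℕ → ℕ → ℕ) : ℕ → ℕ × ℕ
  | 0 => (a 0, g (a 0) 0)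
  | t + 1 =>
      let p := algState a g t
      let n := p.1 - p.2 + a (t + 1)
      (n, g n p.2)

/-- The schedule produced by the online rule `g` on arrival sequence `a`. -/
def algSched (a : ℕ → ℕ) (g : ℕ → ℕ → ℕ) (t : ℕ) : ℕ := (algState a g t).2

theorem algState_id (a : ℕ → ℕ) (t : ℕ) :
    algState a (fun n _ => n) t = (a t, a t) := by
  induction t with
  | zero => rfl
  | succ t ih => simp [algState, ih]

theorem algSched_id (a : ℕ → ℕ) : algSched a (fun n _ => n) = a := by
  funext t
  simp [algSched, algState_id]

theorem backlog_self (a : ℕ → ℕ) (t : ℕ) : backlog a a t = a t := by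
  simp [backlog, cumA, cumS, Finset.sum_range_succ]

/-- Batches of `x` jobs arriving at times `2, 4, …, 2k`. -/
def batchArrivals (k x : ℕ) : ℕ → ℕ :=
  fun t => if 2 ≤ t ∧ t ≤ 2 * k ∧ t % 2 = 0 then x else 0

/-- The schedule with `y` active servers in each of the slots `2, …, 2k + 1`. -/
def flatSchedule (k y : ℕ) : ℕ → ℕ :=
  fun t => if 2 ≤ t ∧ t ≤ 2 * k + 1 then y else 0

/-- The function with value `u` at even and `v` at odd slots of `{2, …, 2k + 1}`, else `0`. -/
def alternating (k u v : ℕ) : ℕ → ℕ :=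
  fun t => if 2 ≤ t ∧ t ≤ 2 * k + 1 then (if t % 2 = 0 then u else v) else 0

theorem sum_alternating (K k u v : ℕ) (h : k ≤ K) :
    ∑ t ∈ Finset.range (2 * k + 2), alternating K u v t = k * (u + v) := by
  induction k with
  | zero => simp [Finset.sum_range_succ, alternating]
  | succ k ih =>
    have h₀ : alternating K u v (2 * k + 2) = u := by
      unfold alternating
      rw [if_pos (by omega), if_pos (by omega)]
    have h₁ : alternating K u v (2 * k + 2 + 1) = v := by
      unfold alternating
      rw [if_pos (by omega), if_neg (by omega)]
    rw [show 2 * (k + 1) + 2 = 2 * k + 2 + 1 + 1 by ring, Finset.sum_range_succ,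
      Finset.sum_range_succ, ih (by omega), h₀, h₁]
    ring

theorem tsum_alternating (k u v : ℕ) :
    ∑' t, (alternating k u v t : ℝ≥0∞) = ((k * (u + v) : ℕ) : ℝ≥0∞) := by
  rw [tsum_eq_sum (s := Finset.range (2 * k + 2)), ← Nat.cast_sum, sum_alternating k k u v le_rfl]
  intro t ht
  rw [Finset.mem_range] at ht
  simp only [alternating, if_neg (show ¬(2 ≤ t ∧ t ≤ 2 * k + 1) by omega), Nat.cast_zero]

theorem cumA_batchArrivals (k x t : ℕ) : cumA (batchArrivals k x) t = min (t / 2) k * x := by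
  unfold cumA
  induction t with
  | zero => simp [batchArrivals]
  | succ t ih =>
    rw [Finset.sum_range_succ, ih, batchArrivals]
    split_ifs with h
    · rw [show min ((t + 1) / 2) k = min (t / 2) k + 1 by omega]
      ring
    · rw [show min ((t + 1) / 2) k = min (t / 2) k by omega, add_zero]

theorem cumS_flatSchedule (k y t : ℕ) :
    cumS (flatSchedule k y) t = (min t (2 * k + 2) - 2) * y := by
  unfold cumS
  induction t with
  | zero => simp
  | succ t ih =>
    rw [Finset.sum_range_succ, ih, flatSchedule]
    split_ifs with h
    · rw [show min (t + 1) (2 * k + 2) - 2 = min t (2 * k + 2) - 2 + 1 by omega]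
      ring
    · rw [show min (t + 1) (2 * k + 2) - 2 = min t (2 * k + 2) - 2 by omega, add_zero]

theorem backlog_flatSchedule (k y t : ℕ) :
    backlog (batchArrivals k (2 * y)) (flatSchedule k y) t = alternating k (2 * y) y t := by
  rw [backlog, cumA_batchArrivals, cumS_flatSchedule, ← mul_assoc, ← Nat.sub_mul, alternating]
  split_ifs with h h'
  · rw [show min (t / 2) k * 2 - (min t (2 * k + 2) - 2) = 2 by omega]
  · rw [show min (t / 2) k * 2 - (min t (2 * k + 2) - 2) = 1 by omega, one_mul]
  · rw [show min (t / 2) k * 2 - (min t (2 * k + 2) - 2) = 0 by omega, zero_mul]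

theorem feasible_flatSchedule (k y : ℕ) :
    Feasible (batchArrivals k (2 * y)) (flatSchedule k y) := by
  intro t
  rw [backlog_flatSchedule, flatSchedule, alternating]
  split_ifs <;> omega

theorem finSupp_batchArrivals (k x : ℕ) : FinSupp (batchArrivals k x) :=
  ⟨2 * k, fun t ht => if_neg (by omega)⟩

theorem natAbs_switch_batchArrivals (k x t : ℕ) :
    ((batchArrivals k x t : ℤ) - (sPrev (batchArrivals k x) t : ℤ)).natAbs =
      alternating k x x t := by
  cases t with
  | zero => simp [batchArrivals, sPrev, alternating]
  | succ t =>
    simp only [batchArrivals, sPrev, alternating]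
    split_ifs <;> omega

theorem natAbs_switch_flatSchedule {k : ℕ} (hk : 0 < k) (y t : ℕ) :
    ((flatSchedule k y t : ℤ) - (sPrev (flatSchedule k y) t : ℤ)).natAbs =
      (if t = 2 then y else 0) + (if t = 2 * k + 2 then y else 0) := by
  cases t with
  | zero => simp [flatSchedule, sPrev]
  | succ t =>
    simp only [flatSchedule, sPrev]
    split_ifs <;> omega

theorem costLin_batchArrivals_id (k x : ℕ) :
    costLin 1 (batchArrivals k x) (algSched (batchArrivals k x) (fun n _ => n)) =
      ((3 * k * x : ℕ) : ℝ≥0∞) := by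
  have h (t : ℕ) : batchArrivals k x t = alternating k x 0 t := by
    unfold batchArrivals alternating
    split_ifs <;> omega
  simp only [algSched_id, costLin, backlog_self, natAbs_switch_batchArrivals]
  simp only [h, tsum_alternating, ENNReal.ofReal_one, one_mul]
  push_cast
  ring

theorem costLin_flatSchedule {k : ℕ} (hk : 0 < k) (y : ℕ) :
    costLin 1 (batchArrivals k (2 * y)) (flatSchedule k y) =
      ((3 * k * y + 2 * y : ℕ) : ℝ≥0∞) := by
  simp only [costLin, backlog_flatSchedule, natAbs_switch_flatSchedule hk, tsum_alternating,
    ENNReal.ofReal_one, one_mul, Nat.cast_add, Nat.cast_ite, Nat.cast_zero, ENNReal.tsum_add,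
    tsum_ite_eq]
  push_cast
  ring

/-- For `α = 1`, the guarantee of 2 for `A_f` (which sets
`s(t) = n(t)`) is tight, witnessed by the instance where `x` jobs (`x` even)
arrive at times `2, 4, …, 2k`: there `A_f` has cost `3kx` while the feasible
schedule serving `x/2` jobs per slot from slot `2` on has cost at most
`1.5·k·x + x`. -/
theorem Af_tightness :
    (∀ ε : ℝ, 0 < ε → ∃ (a s' : ℕ → ℕ), FinSupp a ∧ Feasible a s' ∧
      ENNReal.ofReal (2 - ε) * costLin 1 a s' ≤ costLin 1 a (algSched a (fun n _ => n))) ∧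
    (∀ k x : ℕ, 0 < k → 0 < x → Even x →
      ∀ a s' : ℕ → ℕ,
        a = (fun t => if 2 ≤ t ∧ t ≤ 2 * k ∧ t % 2 = 0 then x else 0) →
        s' = (fun t => if 2 ≤ t ∧ t ≤ 2 * k + 1 then x / 2 else 0) →
        costLin 1 a (algSched a (fun n _ => n)) = ((3 * k * x : ℕ) : ℝ≥0∞) ∧
        Feasible a s' ∧
        costLin 1 a s' ≤ (3 / 2 : ℝ≥0∞) * (k : ℝ≥0∞) * (x : ℝ≥0∞) + (x : ℝ≥0∞)) := by
  refine ⟨fun ε hε => ?_, ?_⟩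
  · obtain ⟨k, hk⟩ := exists_nat_gt (4 / ε)
    have hk₀ : 0 < k := by
      have : (0 : ℝ) < k := lt_trans (by positivity) hk
      exact_mod_cast this
    refine ⟨batchArrivals k (2 * 1), flatSchedule k 1, finSupp_batchArrivals _ _,
      feasible_flatSchedule _ _, ?_⟩
    rw [costLin_batchArrivals_id, costLin_flatSchedule hk₀, ← ENNReal.ofReal_natCast,
      ← ENNReal.ofReal_natCast, ← ENNReal.ofReal_mul' (Nat.cast_nonneg _)]
    apply ENNReal.ofReal_le_ofReal
    rw [div_lt_iff₀ hε] at hk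
    push_cast
    nlinarith [mul_nonneg hε.le (Nat.cast_nonneg (α := ℝ) k)]
  · rintro k x hk - ⟨y, rfl⟩ a s' rfl rfl
    rw [← two_mul, Nat.mul_div_cancel_left y two_pos]
    refine ⟨costLin_batchArrivals_id k _, feasible_flatSchedule k y, ?_⟩
    refine (costLin_flatSchedule hk y).le.trans (le_of_eq ?_)
    have h : (3 / 2 : ℝ≥0∞) * 2 = 3 := ENNReal.div_mul_cancel two_ne_zero ENNReal.ofNat_ne_top
    push_cast
    rw [show (3 / 2 : ℝ≥0∞) * k * (2 * y) = 3 / 2 * 2 * k * y by ring, h]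
end

section
/- The balancing algorithm A_bal-1, which sets s(t) = min{n(t), ⌈n(t)/α⌉}, has unbounded competitive ratio for flow time plus linear switching cost: for every M > 0 there exist a weight α > 1, an arrival sequence a, and a feasible schedule s' such that C(A_bal-1) ≥ M·C(s'). In particular, for the instance where N jobs arrive at time 0 (and none later) and α = N, A_bal-1 has cost Ω(N²), while the schedule that runs ⌈N/√α⌉ servers until the work is exhausted has cost O(N^{3/2}). -/
open scoped BigOperators ENNReal

/-- The balancing rule of `A_bal-1`: `s(t) = min {n(t), ⌈n(t)/α⌉}`. -/
noncomputable def bal1Rule (α : ℝ) : ℕ → ℕ → ℕ := fun n _ => min n ⌈(n : ℝ) / α⌉₊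

theorem cumA_succ (a : ℕ → ℕ) (t : ℕ) : cumA a (t + 1) = cumA a t + a (t + 1) :=
  Finset.sum_range_succ _ _

theorem cumS_succ (s : ℕ → ℕ) (t : ℕ) : cumS s (t + 1) = cumS s t + s t :=
  Finset.sum_range_succ _ _

/-- A rule that never exceeds the backlog keeps the books balanced: every job that has arrived is
either served or recorded in the first state component. -/
theorem cumA_eq_cumS_add_algState (a : ℕ → ℕ) (g : ℕ → ℕ → ℕ) (hg : ∀ n p, g n p ≤ n) (t : ℕ) :
    cumA a t = cumS (algSched a g) t + (algState a g t).1 ∧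
      (algState a g t).2 ≤ (algState a g t).1 := by
  induction t with
  | zero => simp [cumA, cumS, algState, hg]
  | succ t ih =>
    refine ⟨?_, hg _ _⟩
    rw [cumA_succ, cumS_succ]
    simp only [algSched, algState] at ih ⊢
    omega

theorem backlog_algSched (a : ℕ → ℕ) (g : ℕ → ℕ → ℕ) (hg : ∀ n p, g n p ≤ n) (t : ℕ) :
    backlog a (algSched a g) t = (algState a g t).1 := by
  have h := (cumA_eq_cumS_add_algState a g hg t).1
  unfold backlog
  omega

theorem feasible_algSched (a : ℕ → ℕ) (g : ℕ → ℕ → ℕ) (hg : ∀ n p, g n p ≤ n) :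
    Feasible a (algSched a g) := fun t => by
  rw [backlog_algSched a g hg]
  exact (cumA_eq_cumS_add_algState a g hg t).2

/-- On a single batch of `N` jobs, a rule that runs `K` servers while work remains has the
explicit trajectory `N - t * K`. -/
theorem algState_batch (N K : ℕ) (g : ℕ → ℕ → ℕ) (hg : ∀ n ≤ N, ∀ p, g n p = min n K) (t : ℕ) :
    algState (fun t => if t = 0 then N else 0) g t = (N - t * K, min (N - t * K) K) := by
  induction t with
  | zero => simp [algState, hg]
  | succ t ih =>
    have h : N - t * K - min (N - t * K) K = N - (t + 1) * K := by
      rw [Nat.succ_mul]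
      omega
    simp only [algState, ih, Nat.add_eq_zero_iff, one_ne_zero, and_false, if_false, add_zero, h]
    rw [hg _ (Nat.sub_le _ _)]

/-- The total linear switching of a nonincreasing schedule is at most twice its initial value. -/
theorem tsum_switching_le_of_antitone (s : ℕ → ℕ) (hs : Antitone s) :
    ∑' t, (((s t : ℤ) - (sPrev s t : ℤ)).natAbs : ℝ≥0∞) ≤ ((2 * s 0 : ℕ) : ℝ≥0∞) := by
  have key : ∀ n, ∑ t ∈ Finset.range (n + 1), ((s t : ℤ) - (sPrev s t : ℤ)).natAbs + s n
      = 2 * s 0 := by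
    intro n
    induction n with
    | zero =>
      simp only [zero_add, Finset.sum_range_one, sPrev]
      omega
    | succ n ih =>
      rw [Finset.sum_range_succ]
      have hmono : s (n + 1) ≤ s n := hs (Nat.le_succ n)
      have hprev : sPrev s (n + 1) = s n := rfl
      rw [hprev]
      omega
  refine ENNReal.tsum_le_of_sum_range_le fun n => ?_
  have h : ∑ t ∈ Finset.range n, ((s t : ℤ) - (sPrev s t : ℤ)).natAbs ≤ 2 * s 0 := by
    have := key n
    rw [Finset.sum_range_succ] at this
    omega
  exact_mod_cast h

theorem bal1Rule_self (N n : ℕ) (hn : n ≤ N) (p : ℕ) : bal1Rule N n p = min n 1 := by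
  unfold bal1Rule
  rcases Nat.eq_zero_or_pos n with rfl | h
  · simp
  · have hN : (0 : ℝ) < N := by exact_mod_cast h.trans_le hn
    have hn' : (0 : ℝ) < n := by exact_mod_cast h
    have : ⌈(n : ℝ) / N⌉₊ = 1 := by
      apply le_antisymm
      · rw [Nat.ceil_le, Nat.cast_one, div_le_one hN]
        exact_mod_cast hn
      · exact Nat.one_le_iff_ne_zero.mpr (Nat.ceil_pos.mpr (by positivity)).ne'
    rw [this]

theorem sq_le_two_mul_sum_sub (N : ℕ) : N ^ 2 ≤ 2 * ∑ t ∈ Finset.range N, (N - t) := by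
  have h : ∑ t ∈ Finset.range N, (N - t) = ∑ t ∈ Finset.range N, (t + 1) := by
    rw [← Finset.sum_range_reflect]
    refine Finset.sum_congr rfl fun t ht => ?_
    have := Finset.mem_range.mp ht
    omega
  rw [h]
  clear h
  induction N with
  | zero => simp
  | succ n ih =>
    rw [Finset.sum_range_succ]
    nlinarith

/-- `A_bal-1` with weight `N` pays at least `N ^ 2 / 2` on a batch of `N` jobs. -/
theorem le_costLin_bal1_batch (N : ℕ) :
    ENNReal.ofReal (1 / 2 * (N : ℝ) ^ 2) ≤
      costLin N (fun t => if t = 0 then N else 0)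
        (algSched (fun t => if t = 0 then N else 0) (bal1Rule N)) := by
  refine le_trans ?_ (le_self_add.trans' (ENNReal.sum_le_tsum (Finset.range N)))
  have hb : ∀ t, backlog (fun t => if t = 0 then N else 0)
      (algSched (fun t => if t = 0 then N else 0) (bal1Rule N)) t = N - t := by
    intro t
    rw [backlog_algSched _ (bal1Rule N) (fun n p => min_le_left _ _),
      algState_batch N 1 _ (bal1Rule_self N), mul_one]
  simp only [hb]
  rw [← Nat.cast_sum, ← ENNReal.ofReal_natCast]
  apply ENNReal.ofReal_le_ofReal
  have : (N : ℝ) ^ 2 ≤ 2 * ((∑ t ∈ Finset.range N, (N - t) : ℕ) : ℝ) := by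
    exact_mod_cast sq_le_two_mul_sum_sub N
  linarith

/-- Running `K` servers on a batch of `N ≤ K ^ 2` jobs costs at most `3 * K * N` at weight `N`. -/
theorem costLin_batch_le (N K : ℕ) (hK : N ≤ K * K) :
    costLin N (fun t => if t = 0 then N else 0)
        (algSched (fun t => if t = 0 then N else 0) (fun n _ => min n K)) ≤
      ((3 * (K * N) : ℕ) : ℝ≥0∞) := by
  have hst := algState_batch N K (fun n _ => min n K) (fun _ _ _ => rfl)
  have hs : algSched (fun t => if t = 0 then N else 0) (fun n _ => min n K) =
      fun t => min (N - t * K) K := by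
    funext t
    rw [algSched, hst]
  have hflow : ∑' t, (backlog (fun t => if t = 0 then N else 0)
      (algSched (fun t => if t = 0 then N else 0) (fun n _ => min n K)) t : ℝ≥0∞) ≤
      ((K * N : ℕ) : ℝ≥0∞) := by
    simp only [backlog_algSched _ _ (fun n _ => min_le_left n K), hst]
    rw [tsum_eq_sum (s := Finset.range K), ← Nat.cast_sum]
    · refine Nat.cast_le.mpr ((Finset.sum_le_card_nsmul _ _ N fun t _ => Nat.sub_le _ _).trans ?_)
      simp
    · intro t ht
      have hKt : K ≤ t := by simpa using ht
      rw [Nat.sub_eq_zero_of_le (hK.trans (Nat.mul_le_mul_right K hKt)), Nat.cast_zero]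
  have hswitch := tsum_switching_le_of_antitone
    (algSched (fun t => if t = 0 then N else 0) (fun n _ => min n K)) (by
      rw [hs]
      intro t u htu
      have := Nat.mul_le_mul_right K htu
      dsimp only
      omega)
  have h0 : algSched (fun t => if t = 0 then N else 0) (fun n _ => min n K) 0 ≤ K := by
    rw [hs]
    exact min_le_right _ _
  unfold costLin
  rw [ENNReal.ofReal_natCast]
  calc _ ≤ ((K * N : ℕ) : ℝ≥0∞) + (N : ℝ≥0∞) * ((2 * K : ℕ) : ℝ≥0∞) := by
        gcongr
        exact hswitch.trans (by gcongr)
    _ = ((3 * (K * N) : ℕ) : ℝ≥0∞) := by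
        push_cast
        ring

theorem rpow_three_halves (N : ℕ) : (N : ℝ) ^ ((3 : ℝ) / 2) = N * √N := by
  rcases Nat.eq_zero_or_pos N with rfl | h
  · simp
  · have hN : (0 : ℝ) < N := by exact_mod_cast h
    rw [show (3 : ℝ) / 2 = 1 + 1 / 2 by norm_num, Real.rpow_add hN, Real.rpow_one,
      Real.sqrt_eq_rpow]

/-- Running `⌈N / √N⌉` servers on a batch of `N` jobs costs `O(N ^ (3 / 2))` at weight `N`. -/
theorem costLin_sqrt_batch_le (N : ℕ) (hN : 1 ≤ N) :
    costLin N (fun t => if t = 0 then N else 0)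
        (algSched (fun t => if t = 0 then N else 0)
          (fun n _ => min n ⌈(N : ℝ) / Real.sqrt (N : ℝ)⌉₊)) ≤
      ENNReal.ofReal (6 * (N : ℝ) ^ ((3 : ℝ) / 2)) := by
  have hN' : (1 : ℝ) ≤ N := by exact_mod_cast hN
  have hsq : 1 ≤ √(N : ℝ) := Real.one_le_sqrt.mpr hN'
  rw [Real.div_sqrt]
  have hle : √(N : ℝ) ≤ (⌈√(N : ℝ)⌉₊ : ℝ) := Nat.le_ceil _
  have hlt : (⌈√(N : ℝ)⌉₊ : ℝ) < √(N : ℝ) + 1 := Nat.ceil_lt_add_one (by positivity)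
  refine (costLin_batch_le N _ ?_).trans ?_
  · have : (N : ℝ) ≤ ⌈√(N : ℝ)⌉₊ * ⌈√(N : ℝ)⌉₊ := by
      nlinarith [Real.mul_self_sqrt (Nat.cast_nonneg (α := ℝ) N)]
    exact_mod_cast this
  · rw [← ENNReal.ofReal_natCast, rpow_three_halves]
    apply ENNReal.ofReal_le_ofReal
    push_cast
    nlinarith

/-- `A_bal-1` has unbounded competitive ratio for flow time plus
linear switching cost; in particular on the instance with `N` jobs at time `0`
and `α = N` it pays `Ω(N²)`, while the schedule running `⌈N/√α⌉` servers until
the work is exhausted pays `O(N^{3/2})`. -/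
theorem bal1_unbounded :
    (∀ M : ℝ, 0 < M → ∃ (α : ℝ) (a s' : ℕ → ℕ), 1 < α ∧ FinSupp a ∧ Feasible a s' ∧
      ENNReal.ofReal M * costLin α a s' ≤ costLin α a (algSched a (bal1Rule α))) ∧
    (∃ c₁ c₂ : ℝ, 0 < c₁ ∧ 0 < c₂ ∧ ∃ N₀ : ℕ, ∀ N : ℕ, N₀ ≤ N →
      ∀ a s' : ℕ → ℕ,
        a = (fun t => if t = 0 then N else 0) →
        s' = algSched a (fun n _ => min n ⌈(N : ℝ) / Real.sqrt (N : ℝ)⌉₊) →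
        ENNReal.ofReal (c₁ * (N : ℝ) ^ 2) ≤ costLin N a (algSched a (bal1Rule N)) ∧
        Feasible a s' ∧
        costLin N a s' ≤ ENNReal.ofReal (c₂ * (N : ℝ) ^ ((3 : ℝ) / 2))) := by
  have feas : ∀ N : ℕ, Feasible (fun t => if t = 0 then N else 0)
      (algSched (fun t => if t = 0 then N else 0)
        (fun n _ => min n ⌈(N : ℝ) / Real.sqrt (N : ℝ)⌉₊)) :=
    fun N => feasible_algSched _ _ fun n _ => min_le_left _ _
  refine ⟨fun M hM => ?_, 1 / 2, 6, by norm_num, by norm_num, 1, ?_⟩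
  · obtain ⟨N, hN⟩ := exists_nat_gt (max 1 ((12 * M) ^ 2))
    have hN1 : (1 : ℝ) < N := (le_max_left _ _).trans_lt hN
    have hNM : 12 * M ≤ √(N : ℝ) :=
      Real.le_sqrt_of_sq_le ((le_max_right _ _).trans hN.le)
    refine ⟨N, _, _, hN1, ⟨0, fun t ht => if_neg ht.ne'⟩, feas N, ?_⟩
    refine le_trans ?_ (le_costLin_bal1_batch N)
    refine (mul_le_mul_right (costLin_sqrt_batch_le N (by exact_mod_cast hN1.le)) _).trans ?_
    rw [← ENNReal.ofReal_mul hM.le, rpow_three_halves]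
    apply ENNReal.ofReal_le_ofReal
    have hsq := Real.mul_self_sqrt (Nat.cast_nonneg (α := ℝ) N)
    calc M * (6 * (N * √(N : ℝ))) = 1 / 2 * N * (12 * M * √(N : ℝ)) := by ring
      _ ≤ 1 / 2 * N * (√(N : ℝ) * √(N : ℝ)) := by gcongr
      _ = 1 / 2 * (N : ℝ) ^ 2 := by
        rw [hsq]
        ring
  · rintro N hN a s' rfl rfl
    exact ⟨le_costLin_bal1_batch N, feas N, costLin_sqrt_batch_le N hN⟩
end
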